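/- arXiv:quant-ph/0411095 — 7 statements merged into one kernel-verified Lean document; each statement's English description precedes it below -/
import Mathlib

section
/- A linear map Λ on M_d(ℂ) is completely positive if and only if the Choi matrix (id_d⊗Λ)[P⁺_d] is positive semidefinite. -/
open Matrix
open scoped Kronecker ComplexOrder

noncomputable section

/-- `id ⊗ Λ` : the map acting as the identity on the first tensor factor and as `Λ`
on the second, written blockwise. -/
def idTensor {p q : Type*} (Λ : Matrix q q ℂ → Matrix q q ℂ)
    (ρ : Matrix (p × q) (p × q) ℂ) : Matrix (p × q) (p × q) ℂ :=
  Matrix.of fun x y => Λ (Matrix.of fun a b => ρ (x.1, a) (y.1, b)) x.2 y.2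

/-- Complete positivity: all the extensions `id_n ⊗ Λ` are positive. -/
def CompletelyPositive {q : Type*} [Fintype q] (Λ : Matrix q q ℂ →ₗ[ℂ] Matrix q q ℂ) : Prop :=
  ∀ n : ℕ, ∀ ρ : Matrix (Fin n × q) (Fin n × q) ℂ, ρ.PosSemidef → (idTensor (⇑Λ) ρ).PosSemidef

/-- The maximally entangled vector `|Ψ⁺⟩ = (1/√d) ∑ⱼ |j⟩⊗|j⟩`. -/
def maxEntVec (q : Type*) [Fintype q] [DecidableEq q] : q × q → ℂ :=
  fun x => if x.1 = x.2 then (((Real.sqrt (Fintype.card q) : ℝ) : ℂ))⁻¹ else 0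

/-- The projection `P⁺ = |Ψ⁺⟩⟨Ψ⁺|` onto the maximally entangled vector. -/
def Pplus (q : Type*) [Fintype q] [DecidableEq q] : Matrix (q × q) (q × q) ℂ :=
  vecMulVec (maxEntVec q) (star (maxEntVec q))

lemma posSemidef_Pplus (q : Type*) [Fintype q] [DecidableEq q] : (Pplus q).PosSemidef :=
  posSemidef_vecMulVec_self_star _

/-- The blocks of the Choi matrix are the images of the matrix units, divided by the dimension. -/
lemma idTensor_Pplus_apply {q : Type*} [Fintype q] [DecidableEq q]
    (Λ : Matrix q q ℂ →ₗ[ℂ] Matrix q q ℂ) (a b i j : q) :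
    idTensor (⇑Λ) (Pplus q) (a, i) (b, j) =
      (Fintype.card q : ℂ)⁻¹ * Λ (Matrix.single a b 1) i j := by
  have hsqrt : ((Real.sqrt (Fintype.card q) : ℝ) : ℂ) * ((Real.sqrt (Fintype.card q) : ℝ) : ℂ) =
      Fintype.card q := by
    rw [← Complex.ofReal_mul, Real.mul_self_sqrt (Nat.cast_nonneg _), Complex.ofReal_natCast]
  have hblock : (Matrix.of fun s t => Pplus q (a, s) (b, t)) =
      (Fintype.card q : ℂ)⁻¹ • Matrix.single a b (1 : ℂ) := by
    ext s t
    by_cases hs : a = s <;> by_cases ht : b = t <;>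
      simp [Pplus, vecMulVec_apply, maxEntVec, hs, ht, ← hsqrt]
  simp only [idTensor, Matrix.of_apply, hblock, map_smul, Matrix.smul_apply, smul_eq_mul]

/-- A linear map is recovered from its Choi matrix. -/
lemma apply_eq_sum_idTensor_Pplus {q : Type*} [Fintype q] [DecidableEq q]
    (Λ : Matrix q q ℂ →ₗ[ℂ] Matrix q q ℂ) (X : Matrix q q ℂ) (i j : q) :
    Λ X i j = Fintype.card q * ∑ a, ∑ b, X a b * idTensor (⇑Λ) (Pplus q) (a, i) (b, j) := by
  have hcard : (Fintype.card q : ℂ) ≠ 0 :=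
    Nat.cast_ne_zero.mpr (Fintype.card_pos_iff.mpr ⟨i⟩).ne'
  have hX : X = ∑ a, ∑ b, X a b • Matrix.single a b (1 : ℂ) := by
    conv_lhs => rw [matrix_eq_sum_single X]
    simp
  conv_lhs => rw [hX]
  simp only [map_sum, map_smul, Matrix.sum_apply, Matrix.smul_apply, smul_eq_mul,
    idTensor_Pplus_apply, Finset.mul_sum]
  refine Finset.sum_congr rfl fun a _ => Finset.sum_congr rfl fun b _ => ?_
  field_simp

/-- If `ρ = Bᴴ B`, then `(id ⊗ Λ)[ρ]` is a sum of congruences of the Choi matrix of `Λ`, one for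
each row of `B`. -/
lemma idTensor_conjTranspose_mul_self {m p q : Type*} [Fintype m] [Fintype q] [DecidableEq q]
    (Λ : Matrix q q ℂ →ₗ[ℂ] Matrix q q ℂ) (B : Matrix m (p × q) ℂ) :
    idTensor (⇑Λ) (Bᴴ * B) = (Fintype.card q : ℂ) • ∑ k,
      ((Matrix.of fun a x => B k (x, a)) ⊗ₖ (1 : Matrix q q ℂ))ᴴ * idTensor (⇑Λ) (Pplus q) *
        ((Matrix.of fun a x => B k (x, a)) ⊗ₖ (1 : Matrix q q ℂ)) := by
  ext ⟨x, i⟩ ⟨y, j⟩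
  change Λ _ i j = _
  rw [apply_eq_sum_idTensor_Pplus]
  simp only [Matrix.smul_apply, Matrix.sum_apply, smul_eq_mul, Matrix.mul_apply,
    Matrix.conjTranspose_apply, Matrix.kroneckerMap_apply, Matrix.of_apply, Matrix.one_apply,
    Fintype.sum_prod_type, mul_ite, mul_one, mul_zero, apply_ite star, star_zero, ite_mul,
    zero_mul, Finset.sum_ite_eq', Finset.mem_univ, if_true, Finset.sum_mul]
  congr 1
  rw [Finset.sum_comm_cycle]
  refine Finset.sum_congr rfl fun k _ => ?_
  rw [Finset.sum_comm]
  refine Finset.sum_congr rfl fun b _ => Finset.sum_congr rfl fun a _ => ?_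
  ring

open scoped MatrixOrder in
/-- If the Choi matrix of `Λ` is positive semidefinite, then every `id ⊗ Λ` is positive. -/
lemma posSemidef_idTensor_of_choi {p q : Type*} [Fintype p] [Fintype q] [DecidableEq q]
    {Λ : Matrix q q ℂ →ₗ[ℂ] Matrix q q ℂ} (hΛ : (idTensor (⇑Λ) (Pplus q)).PosSemidef)
    {ρ : Matrix (p × q) (p × q) ℂ} (hρ : ρ.PosSemidef) : (idTensor (⇑Λ) ρ).PosSemidef := by
  classical
  obtain ⟨B, rfl⟩ := CStarAlgebra.nonneg_iff_eq_star_mul_self.mp hρ.nonneg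
  rw [star_eq_conjTranspose, idTensor_conjTranspose_mul_self]
  exact (posSemidef_sum _ fun k _ => hΛ.conjTranspose_mul_mul_same _).smul (Nat.cast_nonneg _)

/-- Theorem 1 (ii): a linear map `Λ` on `M_d(ℂ)` is completely positive if and only if
its Choi matrix `(id_d⊗Λ)[P⁺_d]` is positive semidefinite. -/
theorem completelyPositive_iff_choi_posSemidef (d : ℕ)
    (Λ : Matrix (Fin d) (Fin d) ℂ →ₗ[ℂ] Matrix (Fin d) (Fin d) ℂ) :
    CompletelyPositive Λ ↔ (idTensor (⇑Λ) (Pplus (Fin d))).PosSemidef := by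
  exact ⟨fun h => h d _ (posSemidef_Pplus _), fun h _ _ hρ => posSemidef_idTensor_of_choi h hρ⟩
end
end

section
/- A linear map Λ on M_d(ℂ) is completely positive if and only if it admits a Kraus–Stinespring representation: there exist matrices G_0, …, G_{d²−1} ∈ M_d(ℂ) such that Λ[ρ] = Σ_{j=0}^{d²−1} G_j ρ G_j† for all ρ ∈ M_d(ℂ). -/
open Matrix
open scoped Kronecker ComplexOrder

noncomputable section

/-- Blockwise conjugation by `G` on the second factor is conjugation by `1 ⊗ G`. -/
lemma idTensor_conj {p q : Type*} [Fintype p] [DecidableEq p] [Fintype q]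
    (G : Matrix q q ℂ) (ρ : Matrix (p × q) (p × q) ℂ) :
    idTensor (fun σ => G * σ * Gᴴ) ρ =
      ((1 : Matrix p p ℂ) ⊗ₖ G) * ρ * ((1 : Matrix p p ℂ) ⊗ₖ G)ᴴ := by
  ext ⟨i, a⟩ ⟨j, b⟩
  simp [idTensor, Matrix.mul_apply, Fintype.sum_prod_type, Matrix.one_apply, Finset.sum_mul,
    apply_ite (star : ℂ → ℂ)]

/-- A map with a Kraus representation is completely positive. -/
lemma completelyPositive_of_kraus {ι q : Type*} [Fintype ι] [Fintype q]
    {Λ : Matrix q q ℂ →ₗ[ℂ] Matrix q q ℂ} (G : ι → Matrix q q ℂ)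
    (hG : ∀ ρ, Λ ρ = ∑ j, G j * ρ * (G j)ᴴ) : CompletelyPositive Λ := by
  intro n ρ hρ
  have h : idTensor (⇑Λ) ρ =
      ∑ j, ((1 : Matrix (Fin n) (Fin n) ℂ) ⊗ₖ G j) * ρ *
        ((1 : Matrix (Fin n) (Fin n) ℂ) ⊗ₖ G j)ᴴ := by
    simp_rw [← idTensor_conj]
    ext x y
    simp [idTensor, hG, Matrix.sum_apply]
  rw [h]
  exact posSemidef_sum _ fun j _ => hρ.mul_mul_conjTranspose_same _

/-- The Choi matrix of a linear map, with `(i, j)` block `Λ (E i j)`. -/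
def choiMatrix {q : Type*} [DecidableEq q] (Λ : Matrix q q ℂ →ₗ[ℂ] Matrix q q ℂ) :
    Matrix (q × q) (q × q) ℂ :=
  Matrix.of fun x y => Λ (Matrix.single x.1 y.1 1) x.2 y.2

lemma CompletelyPositive.choiMatrix_posSemidef {d : ℕ}
    {Λ : Matrix (Fin d) (Fin d) ℂ →ₗ[ℂ] Matrix (Fin d) (Fin d) ℂ} (hΛ : CompletelyPositive Λ) :
    (choiMatrix Λ).PosSemidef := by
  let v : Fin d × Fin d → ℂ := fun x => if x.1 = x.2 then 1 else 0
  have h : choiMatrix Λ = idTensor (⇑Λ) (vecMulVec v (star v)) := by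
    ext ⟨i, a⟩ ⟨j, b⟩
    have hs : (Matrix.of fun k l => vecMulVec v (star v) (i, k) (j, l)) =
        Matrix.single i j (1 : ℂ) := by
      ext k l
      by_cases hk : i = k <;> by_cases hl : j = l <;>
        simp [v, vecMulVec_apply, hk, hl]
    simp only [choiMatrix, idTensor, Matrix.of_apply, hs]
  rw [h]
  exact hΛ d _ (posSemidef_vecMulVec_self_star v)

open scoped MatrixOrder in
lemma Matrix.PosSemidef.exists_eq_conjTranspose_mul_self {m : Type*} [Fintype m]
    [DecidableEq m] {M : Matrix m m ℂ} (hM : M.PosSemidef) :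
    ∃ B : Matrix m m ℂ, M = Bᴴ * B :=
  CStarAlgebra.nonneg_iff_eq_star_mul_self.mp hM.nonneg

/-- A factorization `Bᴴ * B` of the Choi matrix yields Kraus operators. -/
lemma kraus_of_choiMatrix_eq {ι q : Type*} [Fintype ι] [Fintype q] [DecidableEq q]
    {Λ : Matrix q q ℂ →ₗ[ℂ] Matrix q q ℂ} {B : Matrix ι (q × q) ℂ}
    (hB : choiMatrix Λ = Bᴴ * B) (ρ : Matrix q q ℂ) :
    Λ ρ = ∑ k, (Matrix.of fun a i => star (B k (i, a))) * ρ *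
      (Matrix.of fun a i => star (B k (i, a)))ᴴ := by
  have hentry (i j a b : q) :
      Λ (Matrix.single i j 1) a b = ∑ k, star (B k (i, a)) * B k (j, b) := by
    simpa [choiMatrix, Matrix.mul_apply] using congrFun (congrFun hB (i, a)) (j, b)
  have hρ : ρ = ∑ i, ∑ j, ρ i j • Matrix.single i j (1 : ℂ) := by
    simpa [Matrix.smul_single] using Matrix.matrix_eq_sum_single ρ
  ext a b
  conv_lhs => rw [hρ]
  simp only [map_sum, map_smul, Matrix.sum_apply, Matrix.smul_apply, hentry, smul_eq_mul,
    Matrix.mul_apply, Matrix.of_apply, Matrix.conjTranspose_apply, star_star, Finset.mul_sum,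
    Finset.sum_mul]
  rw [Finset.sum_comm]
  simp_rw [Finset.sum_comm (s := Finset.univ (α := q)) (t := Finset.univ (α := ι))]
  refine Finset.sum_congr rfl fun k _ => Finset.sum_congr rfl fun j _ =>
    Finset.sum_congr rfl fun i _ => ?_
  ring

/-- Theorem 1 (iii): a linear map `Λ` on `M_d(ℂ)` is completely positive if and only if
it admits a Kraus–Stinespring representation `Λ[ρ] = ∑_{j=0}^{d²-1} G_j ρ G_j†`. -/
theorem completelyPositive_iff_kraus (d : ℕ)
    (Λ : Matrix (Fin d) (Fin d) ℂ →ₗ[ℂ] Matrix (Fin d) (Fin d) ℂ) :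
    CompletelyPositive Λ ↔
      ∃ G : Fin (d ^ 2) → Matrix (Fin d) (Fin d) ℂ,
        ∀ ρ : Matrix (Fin d) (Fin d) ℂ, Λ ρ = ∑ j, G j * ρ * (G j)ᴴ := by
  constructor
  · intro hΛ
    obtain ⟨B, hB⟩ := hΛ.choiMatrix_posSemidef.exists_eq_conjTranspose_mul_self
    let e : Fin (d ^ 2) ≃ Fin d × Fin d := (finCongr (sq d)).trans finProdFinEquiv.symm
    refine ⟨fun k => Matrix.of fun a i => star (B (e k) (i, a)), fun ρ => ?_⟩
    rw [kraus_of_choiMatrix_eq hB ρ]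
    exact (e.sum_comp fun k => (Matrix.of fun a i => star (B k (i, a))) * ρ *
      (Matrix.of fun a i => star (B k (i, a)))ᴴ).symm
  · rintro ⟨G, hG⟩
    exact completelyPositive_of_kraus G hG
end
end

section
/- Let {G_k}_{k=0}^{d²−1} be an orthonormal basis of M_d(ℂ) with respect to the Hilbert–Schmidt inner product Tr(A†B), let p be a fixed index, and let ℓ_0, …, ℓ_{d²−1} be real numbers with ℓ_k ≥ 0 for all k ≠ p and ℓ_p < 0. Define Λ[ρ] = Σ_{k≠p} ℓ_k G_k ρ G_k† − |ℓ_p| G_p ρ G_p†. If the operator norm of G_p satisfies ‖G_p‖² = M < 1 and ℓ_k ≥ (M/(1−M))·|ℓ_p| for all k ≠ p, then Λ is a positive map. -/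
open Matrix
open scoped Kronecker ComplexOrder

noncomputable section

/-- Conjugating the rank-one matrix `b b†` by `A` gives the rank-one matrix of `A b`. -/
theorem mul_vecMulVec_star_mul_conjTranspose {m n : Type*} [Fintype n]
    (A : Matrix m n ℂ) (b : n → ℂ) :
    A * vecMulVec b (star b) * Aᴴ = vecMulVec (A *ᵥ b) (star (A *ᵥ b)) := by
  rw [mul_vecMulVec, vecMulVec_mul, star_mulVec]

theorem star_dotProduct_vecMulVec_star_mulVec {n : Type*} [Fintype n] (x u : n → ℂ) :
    star x ⬝ᵥ (vecMulVec u (star u) *ᵥ x) = ((‖star x ⬝ᵥ u‖ ^ 2 : ℝ) : ℂ) := by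
  have h : star u ⬝ᵥ x = star (star x ⬝ᵥ u) := by
    rw [star_dotProduct]
  rw [vecMulVec_mulVec, dotProduct_smul, h]
  simp [← Complex.mul_conj']

/-- Cauchy–Schwarz with the operator norm for a matrix coefficient. -/
theorem norm_sq_star_dotProduct_mulVec_le {n : Type*} [Fintype n] [DecidableEq n]
    (A : Matrix n n ℂ) (x b : n → ℂ) :
    ‖star x ⬝ᵥ (A *ᵥ b)‖ ^ 2 ≤
      ‖Matrix.toEuclideanCLM (𝕜 := ℂ) A‖ ^ 2 * ((∑ i, ‖x i‖ ^ 2) * ∑ j, ‖b j‖ ^ 2) := by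
  have h1 : star x ⬝ᵥ (A *ᵥ b) =
      inner ℂ (WithLp.toLp 2 x) (Matrix.toEuclideanCLM (𝕜 := ℂ) A (WithLp.toLp 2 b)) := by
    rw [toEuclideanCLM_toLp, EuclideanSpace.inner_toLp_toLp, dotProduct_comm]
  have h2 := (norm_inner_le_norm (𝕜 := ℂ) (WithLp.toLp 2 x)
    (Matrix.toEuclideanCLM (𝕜 := ℂ) A (WithLp.toLp 2 b))).trans
    (mul_le_mul_of_nonneg_left ((Matrix.toEuclideanCLM (𝕜 := ℂ) A).le_opNorm (WithLp.toLp 2 b))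
      (norm_nonneg _))
  have hx : ∑ i, ‖x i‖ ^ 2 = ‖WithLp.toLp 2 x‖ ^ 2 := by
    rw [EuclideanSpace.norm_sq_eq]
  have hb : ∑ i, ‖b i‖ ^ 2 = ‖WithLp.toLp 2 b‖ ^ 2 := by
    rw [EuclideanSpace.norm_sq_eq]
  rw [h1, hx, hb]
  calc _ ≤ _ := pow_le_pow_left₀ (norm_nonneg _) h2 2
    _ = _ := by ring

theorem star_dotProduct_self_eq_sum_norm_sq {n : Type*} [Fintype n] (w : n → ℂ) :
    star w ⬝ᵥ w = ((∑ i, ‖w i‖ ^ 2 : ℝ) : ℂ) := by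
  simp [dotProduct, Complex.conj_mul']

/-- Parseval's identity for a Hilbert–Schmidt orthonormal basis, applied to a rank-one matrix. -/
theorem sum_norm_sq_star_dotProduct_mulVec {ι n : Type*} [Fintype ι] [DecidableEq ι]
    [Fintype n] (hcard : Fintype.card ι = Fintype.card n ^ 2)
    (G : ι → Matrix n n ℂ)
    (horth : ∀ k l, ((G k)ᴴ * G l).trace = if k = l then 1 else 0) (x b : n → ℂ) :
    ∑ k, ‖star x ⬝ᵥ (G k *ᵥ b)‖ ^ 2 = (∑ i, ‖x i‖ ^ 2) * ∑ j, ‖b j‖ ^ 2 := by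
  classical
  let A : Matrix ι (n × n) ℂ := Matrix.of fun k ij => G k ij.1 ij.2
  let v : n × n → ℂ := fun ij => star (x ij.1) * b ij.2
  have hA : A * Aᴴ = 1 := by
    ext k l
    have hkl : (1 : Matrix ι ι ℂ) k l = ((G l)ᴴ * G k).trace := by
      rw [horth, Matrix.one_apply]
      simp only [eq_comm]
    rw [hkl]
    simp only [A, Matrix.mul_apply, Matrix.of_apply, conjTranspose_apply, Matrix.trace, Matrix.diag,
      Fintype.sum_prod_type]
    rw [Finset.sum_comm]
    simp [mul_comm]
  have hA' : Aᴴ * A = 1 :=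
    (Matrix.mul_eq_one_comm_of_card_eq _ _ _ (by simp [hcard, sq])).mp hA
  have hv : ∀ k, star x ⬝ᵥ (G k *ᵥ b) = (A *ᵥ v) k := by
    intro k
    simp only [A, v, Matrix.of_apply, dotProduct, mulVec, Fintype.sum_prod_type,
      Finset.mul_sum, Pi.star_apply]
    exact Finset.sum_congr rfl fun i _ => Finset.sum_congr rfl fun j _ => by ring
  have key : star (A *ᵥ v) ⬝ᵥ (A *ᵥ v) = star v ⬝ᵥ v := by
    rw [star_mulVec, dotProduct_mulVec, vecMul_vecMul, hA', vecMul_one]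
  rw [star_dotProduct_self_eq_sum_norm_sq, star_dotProduct_self_eq_sum_norm_sq,
    Complex.ofReal_inj] at key
  simp only [hv, key, v, norm_mul, norm_star, mul_pow, Fintype.sum_prod_type,
    Finset.sum_mul_sum]

/-- Proposition 5: if `{G_k}` is a Hilbert–Schmidt orthonormal basis of `M_d(ℂ)`,
`ℓ_k ≥ 0` for `k ≠ p`, `ℓ_p < 0`, `‖G_p‖² = M < 1` (operator norm) and
`ℓ_k ≥ (M/(1−M))|ℓ_p|` for `k ≠ p`, then
`Λ[ρ] = ∑_{k≠p} ℓ_k G_k ρ G_k† − |ℓ_p| G_p ρ G_p†` is a positive map. -/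
theorem positivity_of_one_negative_eigenvalue (d : ℕ)
    (G : Fin (d ^ 2) → Matrix (Fin d) (Fin d) ℂ)
    (horth : ∀ k l, ((G k)ᴴ * G l).trace = if k = l then 1 else 0)
    (p : Fin (d ^ 2)) (ℓ : Fin (d ^ 2) → ℝ)
    (hpos : ∀ k, k ≠ p → 0 ≤ ℓ k) (hneg : ℓ p < 0)
    (M : ℝ) (hM : ‖Matrix.toEuclideanCLM (𝕜 := ℂ) (G p)‖ ^ 2 = M) (hM1 : M < 1)
    (hl : ∀ k, k ≠ p → M / (1 - M) * |ℓ p| ≤ ℓ k) :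
    ∀ ρ : Matrix (Fin d) (Fin d) ℂ, ρ.PosSemidef →
      (∑ k ∈ Finset.univ.erase p, (ℓ k : ℂ) • (G k * ρ * (G k)ᴴ)
        - ((|ℓ p| : ℝ) : ℂ) • (G p * ρ * (G p)ᴴ)).PosSemidef := by
  intro ρ hρ
  obtain ⟨m, v, rfl⟩ := posSemidef_iff_eq_sum_vecMulVec.mp hρ
  have hρH : ∀ k, (G k * (∑ i, vecMulVec (v i) (star (v i))) * (G k)ᴴ) =
      ∑ i, vecMulVec (G k *ᵥ v i) (star (G k *ᵥ v i)) := fun k => by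
    simp only [Finset.mul_sum, Finset.sum_mul, mul_vecMulVec_star_mul_conjTranspose]
  have hcomm : (∑ k ∈ Finset.univ.erase p,
        (ℓ k : ℂ) • (G k * (∑ i, vecMulVec (v i) (star (v i))) * (G k)ᴴ)
        - ((|ℓ p| : ℝ) : ℂ) • (G p * (∑ i, vecMulVec (v i) (star (v i))) * (G p)ᴴ)) =
      ∑ i, (∑ k ∈ Finset.univ.erase p,
        (ℓ k : ℂ) • vecMulVec (G k *ᵥ v i) (star (G k *ᵥ v i))
        - ((|ℓ p| : ℝ) : ℂ) • vecMulVec (G p *ᵥ v i) (star (G p *ᵥ v i))) := by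
    simp only [hρH, Finset.smul_sum, Finset.sum_sub_distrib]
    rw [Finset.sum_comm]
  rw [hcomm]
  refine posSemidef_sum _ fun i _ => ?_
  have hsa : ∀ (c : ℝ) (u : Fin d → ℂ), ((c : ℂ) • vecMulVec u (star u)).IsHermitian := by
    intro c u
    rw [IsHermitian, conjTranspose_smul, (posSemidef_vecMulVec_self_star u).isHermitian.eq]
    simp
  refine PosSemidef.of_dotProduct_mulVec_nonneg
    ((isSelfAdjoint_sum _ fun k _ => hsa (ℓ k) _).sub (hsa |ℓ p| _)) fun x => ?_
  simp only [sub_mulVec, sum_mulVec, smul_mulVec, dotProduct_sub, dotProduct_sum, dotProduct_smul,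
    star_dotProduct_vecMulVec_star_mulVec, smul_eq_mul]
  norm_cast
  have hpars := sum_norm_sq_star_dotProduct_mulVec (by simp) G horth x (v i)
  rw [← Finset.sum_erase_add _ _ (Finset.mem_univ p)] at hpars
  have hle := norm_sq_star_dotProduct_mulVec_le (G p) x (v i)
  rw [hM] at hle
  set N := (∑ i, ‖x i‖ ^ 2) * ∑ j, ‖v i j‖ ^ 2
  set a := ‖star x ⬝ᵥ (G p *ᵥ v i)‖ ^ 2
  have hsum : M / (1 - M) * |ℓ p| * (N - a) ≤
      ∑ k ∈ Finset.univ.erase p, ℓ k * ‖star x ⬝ᵥ (G k *ᵥ v i)‖ ^ 2 := by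
    rw [← hpars, add_sub_cancel_right, Finset.mul_sum]
    exact Finset.sum_le_sum fun k hk =>
      mul_le_mul_of_nonneg_right (hl k (Finset.ne_of_mem_erase hk)) (by positivity)
  have h1M : 0 < 1 - M := by linarith
  have hfin : M / (1 - M) * |ℓ p| * (N - a) - |ℓ p| * a = |ℓ p| / (1 - M) * (M * N - a) := by
    field_simp
    ring
  have : 0 ≤ |ℓ p| / (1 - M) * (M * N - a) :=
    mul_nonneg (by positivity) (by linarith)
  linarith
end
end

section
/- A density matrix ρ on ℂ^d⊗ℂ^d is entangled (i.e., not separable) if and only if there exists a positive linear map Λ on M_d(ℂ) such that D_Λ[ρ] := Tr[((id_d⊗Λ)[P⁺_d])·ρ] < 0. -/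
open Matrix
open scoped Kronecker ComplexOrder

noncomputable section

/-- A linear map on matrices is *positive* if it sends positive semidefinite
matrices to positive semidefinite matrices. -/
def IsPosMap {q : Type*} [Fintype q] (Λ : Matrix q q ℂ →ₗ[ℂ] Matrix q q ℂ) : Prop :=
  ∀ ρ : Matrix q q ℂ, ρ.PosSemidef → (Λ ρ).PosSemidef

/-- Separability of a bipartite density matrix: a finite convex combination of tensor
products of density matrices. -/
def Separable {q : Type*} [Fintype q] (ρ : Matrix (q × q) (q × q) ℂ) : Prop :=
  ∃ (n : ℕ) (c : Fin n → ℝ) (ρ₁ ρ₂ : Fin n → Matrix q q ℂ),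
    (∀ i, 0 ≤ c i) ∧ (∑ i, c i) = 1 ∧
    (∀ i, (ρ₁ i).PosSemidef ∧ (ρ₁ i).trace = 1) ∧
    (∀ i, (ρ₂ i).PosSemidef ∧ (ρ₂ i).trace = 1) ∧
    ρ = ∑ i, (c i : ℂ) • (ρ₁ i ⊗ₖ ρ₂ i)

/-- In a finite-dimensional real topological vector space, the convex hull of a compact set is
compact. -/
theorem IsCompact.convexHull_of_finiteDimensional {E : Type*} [AddCommGroup E] [Module ℝ E]
    [TopologicalSpace E] [IsTopologicalAddGroup E] [ContinuousSMul ℝ E] [FiniteDimensional ℝ E]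
    {s : Set E} (hs : IsCompact s) : IsCompact (convexHull ℝ s) := by
  rcases s.eq_empty_or_nonempty with rfl | ⟨x₀, hx₀⟩
  · simp
  let N := Module.finrank ℝ E + 1
  let f : (Fin N → ℝ) × (Fin N → E) → E := fun p => ∑ i, p.1 i • p.2 i
  have hf : Continuous f := by fun_prop
  have key : convexHull ℝ s = f '' (stdSimplex ℝ (Fin N) ×ˢ Set.univ.pi fun _ => s) := by
    apply Set.Subset.antisymm
    · intro x hx
      obtain ⟨ι, _, z, w, hz, hai, hw, hw1, rfl⟩ := eq_pos_convex_span_of_mem_convexHull hx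
      have hcard : Fintype.card ι ≤ Fintype.card (Fin N) := by
        rw [Fintype.card_fin]
        exact hai.card_le_finrank_succ.trans (Nat.succ_le_succ (Submodule.finrank_le _))
      obtain ⟨e⟩ := Function.Embedding.nonempty_of_card_le hcard
      have hsum : ∑ i, w i = ∑ j, Function.extend e w 0 j :=
        Fintype.sum_of_injective e e.injective _ _
          (fun j hj => Function.extend_apply' _ _ _ (by simpa using hj))
          (fun i => (e.injective.extend_apply _ _ _).symm)
      refine ⟨(Function.extend e w 0, Function.extend e z fun _ => x₀), ⟨⟨?_, ?_⟩, ?_⟩, ?_⟩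
      · intro j
        by_cases hj : ∃ i, e i = j
        · obtain ⟨i, rfl⟩ := hj
          simpa [e.injective.extend_apply] using (hw i).le
        · simp [Function.extend_apply' _ _ _ hj]
      · rw [← hsum, hw1]
      · intro j _
        by_cases hj : ∃ i, e i = j
        · obtain ⟨i, rfl⟩ := hj
          simpa [e.injective.extend_apply] using hz ⟨i, rfl⟩
        · simpa [Function.extend_apply' _ _ _ hj] using hx₀
      · refine (Fintype.sum_of_injective e e.injective _ _ (fun j hj => ?_) (fun i => ?_)).symm
        · simp [Function.extend_apply' _ _ _ (show ¬∃ i, e i = j by simpa using hj)]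
        · simp [e.injective.extend_apply]
    · rintro _ ⟨⟨w, z⟩, ⟨⟨hw, hw1⟩, hz⟩, rfl⟩
      exact (convex_convexHull ℝ s).sum_mem (fun i _ => hw i) hw1
        (fun i _ => subset_convexHull ℝ s (hz i trivial))
  rw [key]
  exact ((isCompact_stdSimplex ℝ _).prod (isCompact_univ_pi fun _ => hs)).image hf

section

variable {q : Type*} [Fintype q]

/-- The rank-one positive semidefinite matrix `|v⟩⟨v|`. -/
def rankOne {q : Type*} (v : q → ℂ) : Matrix q q ℂ := vecMulVec v (star v)

theorem rankOne_posSemidef (v : q → ℂ) : (rankOne v).PosSemidef :=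
  posSemidef_vecMulVec_self_star v

theorem rankOne_smul {q : Type*} (r : ℝ) (v : q → ℂ) :
    rankOne ((r : ℂ) • v) = ((r ^ 2 : ℝ) : ℂ) • rankOne v := by
  ext i j
  simp [rankOne, vecMulVec_apply]
  ring

theorem trace_rankOne (v : EuclideanSpace ℂ q) :
    (rankOne v.ofLp).trace = ((‖v‖ ^ 2 : ℝ) : ℂ) := by
  rw [EuclideanSpace.norm_sq_eq]
  simp [rankOne, trace, vecMulVec_apply, Complex.mul_conj, Complex.normSq_eq_norm_sq]

theorem Matrix.PosSemidef.exists_eq_sum_rankOne [DecidableEq q] {X : Matrix q q ℂ}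
    (hX : X.PosSemidef) :
    ∃ v : q → q → ℂ, X = ∑ k, rankOne (v k) := by
  obtain ⟨C, rfl⟩ : ∃ C : Matrix q q ℂ, X = Cᴴ * C := by
    open scoped MatrixOrder in
    exact CStarAlgebra.nonneg_iff_eq_star_mul_self.mp hX.nonneg
  refine ⟨fun k i => star (C k i), ?_⟩
  ext i j
  simp [rankOne, mul_apply, Matrix.sum_apply, vecMulVec_apply]

theorem Matrix.PosSemidef.trace_mul_nonneg [DecidableEq q] {A B : Matrix q q ℂ}
    (hA : A.PosSemidef) (hB : B.PosSemidef) : 0 ≤ (A * B).trace := by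
  obtain ⟨v, rfl⟩ := hB.exists_eq_sum_rankOne
  rw [Matrix.mul_sum, trace_sum]
  refine Finset.sum_nonneg fun k _ => ?_
  rw [rankOne, mul_vecMulVec, trace_vecMulVec, dotProduct_comm]
  exact hA.dotProduct_mulVec_nonneg _

theorem convex_setOf_separable : Convex ℝ {ρ : Matrix (q × q) (q × q) ℂ | Separable ρ} := by
  rintro _ ⟨n, c, A, B, hc, hc1, hA, hB, rfl⟩ _ ⟨m, c', A', B', hc', hc1', hA', hB', rfl⟩
    a b ha hb hab
  refine ⟨n + m, Fin.append (fun i => a * c i) (fun i => b * c' i), Fin.append A A',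
    Fin.append B B', ?_, ?_, ?_, ?_, ?_⟩
  · intro i
    refine Fin.addCases (fun i => ?_) (fun i => ?_) i
    · simpa using mul_nonneg ha (hc i)
    · simpa using mul_nonneg hb (hc' i)
  · simp [Fin.sum_univ_add, ← Finset.mul_sum, hc1, hc1', hab]
  · intro i
    refine Fin.addCases (fun i => ?_) (fun i => ?_) i
    · simpa using hA i
    · simpa using hA' i
  · intro i
    refine Fin.addCases (fun i => ?_) (fun i => ?_) i
    · simpa using hB i
    · simpa using hB' i
  · simp only [Fin.sum_univ_add, Fin.append_left, Fin.append_right, Finset.smul_sum]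
    congr 1 <;> refine Finset.sum_congr rfl fun i _ => ?_ <;> ext x y <;> simp [mul_assoc]

theorem separable_kronecker {A B : Matrix q q ℂ} (hA : A.PosSemidef) (hA1 : A.trace = 1)
    (hB : B.PosSemidef) (hB1 : B.trace = 1) : Separable (A ⊗ₖ B) :=
  ⟨1, fun _ => 1, fun _ => A, fun _ => B, by simp, by simp, fun _ => ⟨hA, hA1⟩,
    fun _ => ⟨hB, hB1⟩, by simp⟩

variable (q) in
/-- The pure product states. -/
def pureProducts : Set (Matrix (q × q) (q × q) ℂ) :=
  (fun p : EuclideanSpace ℂ q × EuclideanSpace ℂ q => rankOne p.1.ofLp ⊗ₖ rankOne p.2.ofLp) ''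
    (Metric.sphere 0 1 ×ˢ Metric.sphere 0 1)

variable (q) in
theorem isCompact_pureProducts : IsCompact (pureProducts q) := by
  refine ((isCompact_sphere _ _).prod (isCompact_sphere _ _)).image ?_
  refine continuous_pi fun x => continuous_pi fun y => ?_
  simp only [kroneckerMap_apply, rankOne, vecMulVec_apply, Pi.star_apply]
  fun_prop

theorem separable_of_mem_convexHull_pureProducts {ρ : Matrix (q × q) (q × q) ℂ}
    (h : ρ ∈ convexHull ℝ (pureProducts q)) : Separable ρ := by
  refine convexHull_min ?_ convex_setOf_separable h
  rintro _ ⟨⟨v, w⟩, ⟨hv, hw⟩, rfl⟩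
  rw [mem_sphere_zero_iff_norm] at hv hw
  exact separable_kronecker (rankOne_posSemidef _) (by simp [trace_rankOne, hv])
    (rankOne_posSemidef _) (by simp [trace_rankOne, hw])

theorem exists_smul_unit_of_ne_zero {v : q → ℂ} (hv : v ≠ 0) :
    ∃ (r : ℝ) (u : EuclideanSpace ℂ q), ‖u‖ = 1 ∧ v = (r : ℂ) • u.ofLp := by
  have h0 : WithLp.toLp 2 v ≠ (0 : EuclideanSpace ℂ q) := by simpa using hv
  refine ⟨‖(WithLp.toLp 2 v : EuclideanSpace ℂ q)‖,
    ((‖(WithLp.toLp 2 v : EuclideanSpace ℂ q)‖⁻¹ : ℝ) : ℂ) • WithLp.toLp 2 v, ?_, ?_⟩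
  · simp [norm_smul, h0]
  · have : ((‖(WithLp.toLp 2 v : EuclideanSpace ℂ q)‖ : ℝ) : ℂ) ≠ 0 := by simpa using hv
    simp [smul_smul, this]

/-- An entangled state admits an entanglement witness: a Hermitian functional which is
nonnegative on product states and negative on the given state. -/
theorem exists_witness_of_not_separable {ρ : Matrix (q × q) (q × q) ℂ}
    (hρ : ρ.PosSemidef) (htr : ρ.trace = 1) (hsep : ¬ Separable ρ) :
    ∃ w : Matrix (q × q) (q × q) ℂ →ₗ[ℂ] ℂ, (∀ X, w Xᴴ = star (w X)) ∧
      (∀ u v : q → ℂ, 0 ≤ w (rankOne u ⊗ₖ rankOne v)) ∧ w ρ < 0 := by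
  have : LocallyConvexSpace ℝ (Matrix (q × q) (q × q) ℂ) :=
    inferInstanceAs (LocallyConvexSpace ℝ (q × q → q × q → ℂ))
  obtain ⟨g, c, hg, hc⟩ := RCLike.geometric_hahn_banach_closed_point (𝕜 := ℂ)
    (convex_convexHull ℝ (pureProducts q))
    (isCompact_pureProducts q).convexHull_of_finiteDimensional.isClosed
    (fun h => hsep (separable_of_mem_convexHull_pureProducts h))
  let w : Matrix (q × q) (q × q) ℂ →ₗ[ℂ] ℂ :=
    { toFun := fun X => c * X.trace - (g X + star (g Xᴴ)) / 2
      map_add' := fun X Y => by simp [conjTranspose_add]; ring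
      map_smul' := fun a X => by simp [conjTranspose_smul]; ring }
  have hw : ∀ X, w X = c * X.trace - (g X + star (g Xᴴ)) / 2 := fun _ => rfl
  have hherm : ∀ X : Matrix (q × q) (q × q) ℂ, X.PosSemidef → X.trace = 1 →
      w X = ((c - (g X).re : ℝ) : ℂ) := by
    intro X hX hX1
    rw [hw, hX.isHermitian.eq, hX1]
    apply Complex.ext <;> simp
  refine ⟨w, fun X => ?_, fun u v => ?_, ?_⟩
  · simp [hw, trace_conjTranspose]
    ring
  · rcases eq_or_ne u 0 with rfl | hu₀
    · simp [rankOne]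
    rcases eq_or_ne v 0 with rfl | hv₀
    · simp [rankOne]
    obtain ⟨r, u, hu, rfl⟩ := exists_smul_unit_of_ne_zero hu₀
    obtain ⟨s, v, hv, rfl⟩ := exists_smul_unit_of_ne_zero hv₀
    rw [rankOne_smul, rankOne_smul, smul_kronecker, kronecker_smul, map_smul, map_smul,
      hherm _ ((rankOne_posSemidef _).kronecker (rankOne_posSemidef _))
        (by simp [trace_kronecker, trace_rankOne, hu, hv]), smul_eq_mul, smul_eq_mul]
    have := hg _ (subset_convexHull ℝ _ ⟨(u, v), ⟨by simpa using hu, by simpa using hv⟩, rfl⟩)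
    norm_cast
    exact mul_nonneg (sq_nonneg r) (mul_nonneg (sq_nonneg s) (sub_nonneg.mpr this.le))
  · rw [hherm ρ hρ htr]
    norm_cast
    exact sub_neg.mpr hc

variable [DecidableEq q]

theorem idTensor_Pplus_apply_s4 (Λ : Matrix q q ℂ →ₗ[ℂ] Matrix q q ℂ) (x y : q × q) :
    idTensor Λ (Pplus q) x y
      = (Fintype.card q : ℂ)⁻¹ * Λ (single x.1 y.1 1) x.2 y.2 := by
  have : (Matrix.of fun a b => Pplus q (x.1, a) (y.1, b))
      = (Fintype.card q : ℂ)⁻¹ • single x.1 y.1 (1 : ℂ) := by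
    ext a b
    have h : ((Real.sqrt (Fintype.card q) : ℝ) : ℂ)⁻¹ * ((Real.sqrt (Fintype.card q) : ℝ) : ℂ)⁻¹
        = (Fintype.card q : ℂ)⁻¹ := by
      rw [← mul_inv]
      rw [← Complex.ofReal_mul, Real.mul_self_sqrt (Nat.cast_nonneg _), Complex.ofReal_natCast]
    by_cases h1 : x.1 = a <;> by_cases h2 : y.1 = b <;>
      simp [Pplus, maxEntVec, vecMulVec_apply, h1, h2, h]
  rw [idTensor, of_apply, this, map_smul, Matrix.smul_apply, smul_eq_mul]

theorem trace_idTensor_Pplus_mul (Λ : Matrix q q ℂ →ₗ[ℂ] Matrix q q ℂ)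
    (X : Matrix (q × q) (q × q) ℂ) :
    (idTensor Λ (Pplus q) * X).trace
      = (Fintype.card q : ℂ)⁻¹ * ∑ x, ∑ y, Λ (single x.1 y.1 1) x.2 y.2 * X y x := by
  simp only [trace, diag_apply, mul_apply, idTensor_Pplus_apply_s4, Finset.mul_sum, mul_assoc]

theorem trace_idTensor_Pplus_mul_kronecker (Λ : Matrix q q ℂ →ₗ[ℂ] Matrix q q ℂ)
    (A B : Matrix q q ℂ) :
    (idTensor Λ (Pplus q) * (A ⊗ₖ B)).trace
      = (Fintype.card q : ℂ)⁻¹ * (Λ Aᵀ * B).trace := by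
  rw [trace_idTensor_Pplus_mul]
  congr 1
  have hA : Λ Aᵀ = ∑ i, ∑ j, A j i • Λ (single i j 1) := by
    conv_lhs => rw [matrix_eq_sum_single Aᵀ]
    simp only [map_sum, ← map_smul, smul_single, transpose_apply, smul_eq_mul, mul_one]
  simp only [hA, trace, diag_apply, mul_apply, Fintype.sum_prod_type, Finset.sum_mul, Matrix.sum_apply,
    Matrix.smul_apply, kroneckerMap_apply, smul_eq_mul]
  rw [Finset.sum_comm]
  refine Finset.sum_congr rfl fun x₂ _ => ?_
  refine Finset.sum_congr rfl fun i _ => Finset.sum_congr rfl fun j _ =>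
    Finset.sum_congr rfl fun y₂ _ => ?_
  ring

/-- The map `Λ` determined by `Tr[Λ(X) B] = d · w(Xᵀ ⊗ B)`. -/
def mapOfFunctional (w : Matrix (q × q) (q × q) ℂ →ₗ[ℂ] ℂ) :
    Matrix q q ℂ →ₗ[ℂ] Matrix q q ℂ where
  toFun X := Matrix.of fun a b => (Fintype.card q : ℂ) * w (Xᵀ ⊗ₖ single b a 1)
  map_add' X Y := by
    ext a b
    simp [add_kronecker, mul_add]
  map_smul' c X := by
    ext a b
    simp [smul_kronecker]
    ring

theorem mapOfFunctional_apply (w : Matrix (q × q) (q × q) ℂ →ₗ[ℂ] ℂ) (X : Matrix q q ℂ)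
    (a b : q) :
    mapOfFunctional w X a b = (Fintype.card q : ℂ) * w (Xᵀ ⊗ₖ single b a 1) := rfl

theorem dotProduct_mapOfFunctional_mulVec (w : Matrix (q × q) (q × q) ℂ →ₗ[ℂ] ℂ)
    (X : Matrix q q ℂ) (v : q → ℂ) :
    star v ⬝ᵥ (mapOfFunctional w X *ᵥ v) = (Fintype.card q : ℂ) * w (Xᵀ ⊗ₖ rankOne v) := by
  have h : Xᵀ ⊗ₖ rankOne v = ∑ a, ∑ b, (v b * star (v a)) • (Xᵀ ⊗ₖ single b a 1) := by
    conv_lhs => rw [matrix_eq_sum_single (rankOne v), Finset.sum_comm]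
    ext x y
    simp [Matrix.sum_apply, rankOne, vecMulVec_apply, Matrix.single_apply]
    simp only [mul_comm (X _ _), Finset.sum_mul, ite_mul, zero_mul]
  rw [h]
  simp only [dotProduct, mulVec, mapOfFunctional_apply, map_sum, map_smul, Finset.mul_sum,
    Pi.star_apply, smul_eq_mul]
  refine Finset.sum_congr rfl fun a _ => Finset.sum_congr rfl fun b _ => ?_
  ring

theorem isPosMap_mapOfFunctional {w : Matrix (q × q) (q × q) ℂ →ₗ[ℂ] ℂ}
    (hw : ∀ X, w Xᴴ = star (w X))
    (hpos : ∀ u v : q → ℂ, 0 ≤ w (rankOne u ⊗ₖ rankOne v)) :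
    IsPosMap (mapOfFunctional w) := by
  intro X hX
  refine .of_dotProduct_mulVec_nonneg ?_ fun v => ?_
  · ext a b
    have hXT : Xᵀᴴ = Xᵀ := hX.transpose.isHermitian.eq
    rw [conjTranspose_apply, mapOfFunctional_apply, mapOfFunctional_apply, star_mul', ← hw,
      conjTranspose_kronecker, hXT]
    simp
  · rw [dotProduct_mapOfFunctional_mulVec]
    obtain ⟨u, hu⟩ := hX.transpose.exists_eq_sum_rankOne
    have : Xᵀ ⊗ₖ rankOne v = ∑ k, rankOne (u k) ⊗ₖ rankOne v := by
      rw [hu]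
      ext x y
      simp [Matrix.sum_apply, Finset.sum_mul]
    rw [this, map_sum]
    exact mul_nonneg (Nat.cast_nonneg _) (Finset.sum_nonneg fun k _ => hpos _ _)

theorem trace_idTensor_mapOfFunctional_mul [Nonempty q]
    (w : Matrix (q × q) (q × q) ℂ →ₗ[ℂ] ℂ) (X : Matrix (q × q) (q × q) ℂ) :
    (idTensor (mapOfFunctional w) (Pplus q) * X).trace = w X := by
  have hd : (Fintype.card q : ℂ) ≠ 0 := by simp
  conv_rhs => rw [matrix_eq_sum_single X, Finset.sum_comm]
  rw [trace_idTensor_Pplus_mul, Finset.mul_sum, map_sum]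
  refine Finset.sum_congr rfl fun x _ => ?_
  rw [Finset.mul_sum, map_sum]
  refine Finset.sum_congr rfl fun y _ => ?_
  have : single y x (X y x) = X y x • ((single x.1 y.1 (1 : ℂ))ᵀ ⊗ₖ single y.2 x.2 (1 : ℂ)) := by
    simp [transpose_single, single_kronecker_single]
  rw [this, map_smul, mapOfFunctional_apply, smul_eq_mul]
  field_simp

/-- Separable states are not detected by positive maps. -/
theorem Separable.trace_idTensor_Pplus_mul_nonneg {ρ : Matrix (q × q) (q × q) ℂ}
    (h : Separable ρ) {Λ : Matrix q q ℂ →ₗ[ℂ] Matrix q q ℂ} (hΛ : IsPosMap Λ) :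
    0 ≤ (idTensor Λ (Pplus q) * ρ).trace := by
  obtain ⟨n, c, A, B, hc, -, hA, hB, rfl⟩ := h
  rw [Matrix.mul_sum, trace_sum]
  refine Finset.sum_nonneg fun i _ => ?_
  rw [Matrix.mul_smul, trace_smul, trace_idTensor_Pplus_mul_kronecker, smul_eq_mul]
  refine mul_nonneg (by exact_mod_cast hc i) (mul_nonneg ?_ ?_)
  · rw [inv_nonneg]
    exact Nat.cast_nonneg _
  · exact (hΛ _ (hA i).1.transpose).trace_mul_nonneg (hB i).1

end

/-- Theorem 7 (Horodecki): a bipartite density matrix `ρ` is entangled iff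
`D_Λ[ρ] = Tr[((id_d⊗Λ)[P⁺_d])·ρ] < 0` for some positive map `Λ`. -/
theorem entangled_iff_detected_by_positive_map (d : ℕ)
    (ρ : Matrix (Fin d × Fin d) (Fin d × Fin d) ℂ)
    (hρ : ρ.PosSemidef) (htr : ρ.trace = 1) :
    ¬ Separable ρ ↔
      ∃ Λ : Matrix (Fin d) (Fin d) ℂ →ₗ[ℂ] Matrix (Fin d) (Fin d) ℂ,
        IsPosMap Λ ∧ (idTensor (⇑Λ) (Pplus (Fin d)) * ρ).trace < 0 := by
  constructor
  · intro hsep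
    obtain ⟨w, hw, hpos, hneg⟩ := exists_witness_of_not_separable hρ htr hsep
    have : Nonempty (Fin d) := by
      by_contra h
      rw [not_nonempty_iff] at h
      simp [trace] at htr
    exact ⟨mapOfFunctional w, isPosMap_mapOfFunctional hw hpos,
      by rwa [trace_idTensor_mapOfFunctional_mul]⟩
  · rintro ⟨Λ, hΛ, hneg⟩ hsep
    exact absurd hneg (hsep.trace_idTensor_Pplus_mul_nonneg hΛ).not_gt
end
end

section
/- For α, β ∈ {0,1,2,3} let V_{αβ} := (1₄⊗σ_{αβ}) V (1₄⊗σ_{αβ}), where V is the flip (swap) operator on ℂ⁴⊗ℂ⁴. Then each V_{αβ} is self-adjoint, V_{αβ}|Ψ_{γδ}⟩ = ξ_{αγ}ξ_{βδ}|Ψ_{γδ}⟩ for all γ, δ ∈ {0,1,2,3}, and V_{αβ} = Σ_{γ,δ=0}^{3} ξ_{αγ}ξ_{βδ} P_{γδ}, where ξ_{αγ} = 1 − 2δ_{|α−γ|,2}. -/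
open Matrix
open scoped Kronecker ComplexOrder

noncomputable section

/-- The Pauli matrices; `pauli 0` is the 2×2 identity. -/
def pauli : Fin 4 → Matrix (Fin 2) (Fin 2) ℂ :=
  ![1, !![0, 1; 1, 0], !![0, -Complex.I; Complex.I, 0], !![1, 0; 0, -1]]

/-- `σ_{αβ} = σ_α ⊗ σ_β`, a 4×4 matrix acting on `ℂ⁴ = ℂ²⊗ℂ²`. -/
def sigma2 (α β : Fin 4) : Matrix (Fin 2 × Fin 2) (Fin 2 × Fin 2) ℂ :=
  pauli α ⊗ₖ pauli β

/-- `|Ψ_{αβ}⟩ = (1₄ ⊗ σ_{αβ}) |Ψ⁺₄⟩`. -/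
def PsiLat (α β : Fin 4) : (Fin 2 × Fin 2) × (Fin 2 × Fin 2) → ℂ :=
  ((1 : Matrix (Fin 2 × Fin 2) (Fin 2 × Fin 2) ℂ) ⊗ₖ sigma2 α β).mulVec
    (maxEntVec (Fin 2 × Fin 2))

/-- `P_{αβ} = |Ψ_{αβ}⟩⟨Ψ_{αβ}|`. -/
def PLat (α β : Fin 4) :
    Matrix ((Fin 2 × Fin 2) × (Fin 2 × Fin 2)) ((Fin 2 × Fin 2) × (Fin 2 × Fin 2)) ℂ :=
  vecMulVec (PsiLat α β) (star (PsiLat α β))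

/-- The sign `ξ_{αγ} = 1 − 2δ_{|α−γ|,2}`. -/
def xiSign (α γ : Fin 4) : ℝ := if ((α : ℤ) - (γ : ℤ)).natAbs = 2 then -1 else 1

/-- The flip (swap) operator `V` on `ℂ⁴ ⊗ ℂ⁴`. -/
def flipV : Matrix ((Fin 2 × Fin 2) × (Fin 2 × Fin 2)) ((Fin 2 × Fin 2) × (Fin 2 × Fin 2)) ℂ :=
  Matrix.of fun x y => if x.1 = y.2 ∧ x.2 = y.1 then 1 else 0

/-- `V_{αβ} = (1₄⊗σ_{αβ}) V (1₄⊗σ_{αβ})`. -/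
def VLat (α β : Fin 4) :
    Matrix ((Fin 2 × Fin 2) × (Fin 2 × Fin 2)) ((Fin 2 × Fin 2) × (Fin 2 × Fin 2)) ℂ :=
  ((1 : Matrix (Fin 2 × Fin 2) (Fin 2 × Fin 2) ℂ) ⊗ₖ sigma2 α β) * flipV *
    ((1 : Matrix (Fin 2 × Fin 2) (Fin 2 × Fin 2) ℂ) ⊗ₖ sigma2 α β)

lemma pauli_isHermitian (α : Fin 4) : (pauli α).IsHermitian := by
  fin_cases α <;> ext i j <;> fin_cases i <;> fin_cases j <;> simp [pauli]

/-- Conjugating `σ_γᵀ` by `σ_α` gives back `σ_γ` up to the sign `ξ_{αγ}`. -/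
lemma pauli_mul_transpose_mul (α γ : Fin 4) :
    pauli α * (pauli γ)ᵀ * (pauli α)ᵀ = (xiSign α γ : ℂ) • pauli γ := by
  fin_cases α <;> fin_cases γ <;> ext i j <;> fin_cases i <;> fin_cases j <;>
    simp [pauli, xiSign, Matrix.mul_apply, Fin.sum_univ_two, -cons_mul]

lemma pauli_apply_mul_apply (α : Fin 4) (i j k l : Fin 2) :
    pauli α j k * pauli α i l =
      2⁻¹ * ∑ γ : Fin 4, (xiSign α γ : ℂ) * (pauli γ j i * star (pauli γ l k)) := by
  fin_cases α <;> fin_cases i <;> fin_cases j <;> fin_cases k <;> fin_cases l <;>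
    simp [pauli, xiSign, Fin.sum_univ_four] <;> norm_num

lemma sigma2_isHermitian (α β : Fin 4) : (sigma2 α β).IsHermitian := by
  rw [IsHermitian, sigma2, conjTranspose_kronecker, pauli_isHermitian, pauli_isHermitian]

lemma sigma2_mul_transpose_mul (α β γ δ : Fin 4) :
    sigma2 α β * (sigma2 γ δ)ᵀ * (sigma2 α β)ᵀ =
      ((xiSign α γ * xiSign β δ : ℝ) : ℂ) • sigma2 γ δ := by
  simp only [sigma2, ← kroneckerMap_transpose, ← mul_kronecker_mul, pauli_mul_transpose_mul,
    smul_kronecker, kronecker_smul, smul_smul, Complex.ofReal_mul, mul_comm]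

lemma PsiLat_apply (γ δ : Fin 4) (i j : Fin 2 × Fin 2) :
    PsiLat γ δ (i, j) = 2⁻¹ * sigma2 γ δ j i := by
  have h : √(4 : ℝ) = 2 := by
    rw [show (4 : ℝ) = 2 ^ 2 by norm_num, Real.sqrt_sq zero_le_two]
  rw [PsiLat, mulVec, dotProduct, Fintype.sum_prod_type, Finset.sum_eq_single i,
    Finset.sum_eq_single i]
  · simp [maxEntVec, h, mul_comm]
  · intro k _ hk
    simp [maxEntVec, hk.symm]
  · simp
  · intro k _ hk
    simp [hk.symm]
  · simp

lemma VLat_apply (α β : Fin 4) (i j k l : Fin 2 × Fin 2) :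
    VLat α β (i, j) (k, l) = sigma2 α β j k * sigma2 α β i l := by
  have h (m n : Fin 2 × Fin 2) :
      (((1 : Matrix (Fin 2 × Fin 2) (Fin 2 × Fin 2) ℂ) ⊗ₖ sigma2 α β) * flipV) (i, j) (m, n) =
        if i = n then sigma2 α β j m else 0 := by
    rw [mul_apply, Fintype.sum_prod_type, Finset.sum_eq_single i, Finset.sum_eq_single m]
    · simp [flipV]
    · intro p _ hp
      simp [flipV, hp]
    · simp
    · intro p _ hp
      simp [hp.symm]
    · simp
  rw [VLat, mul_apply, Fintype.sum_prod_type, Finset.sum_eq_single k, Finset.sum_eq_single i]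
  · simp [h]
  · intro p _ hp
    simp [h, hp.symm]
  · simp
  · intro p _ hp
    simp [hp]
  · simp

lemma VLat_isHermitian (α β : Fin 4) : (VLat α β).IsHermitian := by
  ext ⟨i, j⟩ ⟨k, l⟩
  rw [conjTranspose_apply, VLat_apply, VLat_apply, star_mul', (sigma2_isHermitian α β).apply,
    (sigma2_isHermitian α β).apply, mul_comm]

lemma VLat_mulVec_PsiLat (α β γ δ : Fin 4) :
    VLat α β *ᵥ PsiLat γ δ = ((xiSign α γ * xiSign β δ : ℝ) : ℂ) • PsiLat γ δ := by
  ext ⟨i, j⟩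
  have h := congrFun₂ (sigma2_mul_transpose_mul α β γ δ) j i
  simp only [mul_apply, transpose_apply, Matrix.smul_apply, smul_eq_mul] at h
  rw [Pi.smul_apply, smul_eq_mul, PsiLat_apply, mul_left_comm, ← h, mulVec, dotProduct,
    Fintype.sum_prod_type_right, Finset.mul_sum]
  refine Finset.sum_congr rfl fun l _ => ?_
  rw [Finset.sum_mul, Finset.mul_sum]
  refine Finset.sum_congr rfl fun k _ => ?_
  rw [VLat_apply, PsiLat_apply]
  ring

lemma VLat_eq_sum_PLat (α β : Fin 4) :
    VLat α β =
      ∑ γ : Fin 4, ∑ δ : Fin 4, ((xiSign α γ * xiSign β δ : ℝ) : ℂ) • PLat γ δ := by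
  ext ⟨i, j⟩ ⟨k, l⟩
  rw [VLat_apply]
  simp only [sigma2, kroneckerMap_apply, Matrix.sum_apply, Matrix.smul_apply, smul_eq_mul]
  rw [mul_mul_mul_comm, pauli_apply_mul_apply, pauli_apply_mul_apply, mul_mul_mul_comm,
    Finset.sum_mul_sum, Finset.mul_sum]
  refine Finset.sum_congr rfl fun γ _ => ?_
  rw [Finset.mul_sum]
  refine Finset.sum_congr rfl fun δ _ => ?_
  simp only [PLat, vecMulVec_apply, Pi.star_apply, PsiLat_apply, sigma2, kroneckerMap_apply,
    star_mul', star_inv₀, star_ofNat, Complex.ofReal_mul]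
  ring

/-- Lemma 14: each `V_{αβ}` is self-adjoint, with spectral decomposition
`V_{αβ} = ∑_{γδ} ξ_{αγ} ξ_{βδ} P_{γδ}` where `ξ_{αγ} = 1 − 2δ_{|α−γ|,2}`. -/
theorem VLat_selfAdjoint_and_spectral (α β : Fin 4) :
    (VLat α β).IsHermitian
      ∧ (∀ γ δ : Fin 4,
          (VLat α β) *ᵥ PsiLat γ δ = ((xiSign α γ * xiSign β δ : ℝ) : ℂ) • PsiLat γ δ)
      ∧ VLat α β = ∑ γ : Fin 4, ∑ δ : Fin 4, ((xiSign α γ * xiSign β δ : ℝ) : ℂ) • PLat γ δ := by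
  exact ⟨VLat_isHermitian α β, VLat_mulVec_PsiLat α β, VLat_eq_sum_PLat α β⟩
end
end

section
/- Let π = (π_{αβ})_{α,β∈{0,1,2,3}} be a probability distribution on L₁₆ and ρ_π = Σ_{(α,β)} π_{αβ} P_{αβ}. Then the partial transpose over the first factor has spectral decomposition (T₄⊗id₄)[ρ_π] = Σ_{(γ,δ)∈L₁₆} (1/4)·[1 − 2(Q¹_{γ̃δ̃} + Q²_{γ̃δ̃})]·P_{γδ}, where Q¹_{γδ} := Σ_{β≠δ} π_{γβ}, Q²_{γδ} := Σ_{α≠γ} π_{αδ}, and μ̃ := (μ+2) mod 4. Consequently ρ_π is PPT if and only if Q¹_{γδ} + Q²_{γδ} ≤ 1/2 for all (γ,δ) ∈ L₁₆. -/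
open Matrix
open scoped Kronecker ComplexOrder

noncomputable section

/-- Partial transposition on the first tensor factor. -/
def ptFst {p q : Type*} (ρ : Matrix (p × q) (p × q) ℂ) : Matrix (p × q) (p × q) ℂ :=
  Matrix.of fun x y => ρ (y.1, x.2) (x.1, y.2)

/-- A bipartite state is PPT if its partial transpose is positive semidefinite. -/
def IsPPT {p q : Type*} [Fintype p] [Fintype q] (ρ : Matrix (p × q) (p × q) ℂ) : Prop :=
  (ptFst ρ).PosSemidef

theorem PsiLat_apply_s11 (α β : Fin 4) (x : (Fin 2 × Fin 2) × (Fin 2 × Fin 2)) :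
    PsiLat α β x = (pauli α x.2.1 x.1.1 * pauli β x.2.2 x.1.2) / 2 := by
  have h4 : Real.sqrt 4 = 2 := by
    rw [show (4 : ℝ) = 2 ^ 2 by norm_num]
    exact Real.sqrt_sq (by norm_num)
  obtain ⟨⟨a, b⟩, c, d⟩ := x
  simp [PsiLat, mulVec, dotProduct, maxEntVec, sigma2, Fintype.sum_prod_type, one_apply, h4]
  fin_cases a <;> fin_cases b <;> simp <;> ring

theorem PLat_apply (α β : Fin 4) (x y : (Fin 2 × Fin 2) × (Fin 2 × Fin 2)) :
    PLat α β x y =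
      (pauli α x.2.1 x.1.1 * star (pauli α y.2.1 y.1.1)) *
        (pauli β x.2.2 x.1.2 * star (pauli β y.2.2 y.1.2)) / 4 := by
  simp only [PLat, vecMulVec_apply, Pi.star_apply, PsiLat_apply_s11]
  simp
  ring

/-- The sign with which `γ` occurs in the partial transpose of the Bell state `α`. -/
def bellSign (α γ : Fin 4) : ℝ := if α = γ + 2 then -1 else 1

theorem pauli_partialTranspose (α : Fin 4) (a b c d : Fin 2) :
    pauli α b c * star (pauli α d a) =
      (∑ γ : Fin 4, (bellSign α γ : ℂ) * (pauli γ b a * star (pauli γ d c))) / 2 := by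
  fin_cases α <;> fin_cases a <;> fin_cases b <;> fin_cases c <;> fin_cases d <;>
    simp [pauli, bellSign, Fin.sum_univ_four]

theorem pauli_trace_orthogonal (α β : Fin 4) :
    ∑ a : Fin 2, ∑ b : Fin 2, star (pauli α b a) * pauli β b a = if α = β then 2 else 0 := by
  fin_cases α <;> fin_cases β <;> simp [pauli, Fin.sum_univ_two] <;> norm_num

theorem PsiLat_orthonormal (i j : Fin 4 × Fin 4) :
    star (PsiLat i.1 i.2) ⬝ᵥ PsiLat j.1 j.2 = if i = j then 1 else 0 := by
  have h : star (PsiLat i.1 i.2) ⬝ᵥ PsiLat j.1 j.2 =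
      (∑ a : Fin 2, ∑ b : Fin 2, star (pauli i.1 b a) * pauli j.1 b a) *
        (∑ a : Fin 2, ∑ b : Fin 2, star (pauli i.2 b a) * pauli j.2 b a) / 4 := by
    simp only [dotProduct, Pi.star_apply, PsiLat_apply_s11, Fintype.sum_prod_type, Fin.sum_univ_two]
    simp
    ring
  rw [h, pauli_trace_orthogonal, pauli_trace_orthogonal]
  simp only [Prod.ext_iff]
  split_ifs <;> simp_all
  norm_num

theorem ptFst_PLat (α β : Fin 4) :
    ptFst (PLat α β) =
      ∑ γ : Fin 4, ∑ δ : Fin 4, ((bellSign α γ * bellSign β δ / 4 : ℝ) : ℂ) • PLat γ δ := by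
  ext x y
  simp only [ptFst, of_apply, PLat_apply, Matrix.sum_apply, Matrix.smul_apply, smul_eq_mul]
  rw [pauli_partialTranspose α x.1.1 x.2.1 y.1.1 y.2.1,
    pauli_partialTranspose β x.1.2 x.2.2 y.1.2 y.2.2, div_mul_div_comm, Finset.sum_mul_sum,
    Finset.sum_div, Finset.sum_div]
  refine Finset.sum_congr rfl fun γ _ => ?_
  rw [Finset.sum_div, Finset.sum_div]
  refine Finset.sum_congr rfl fun δ _ => ?_
  push_cast
  ring

theorem ptFst_sum_smul_PLat (π : Fin 4 → Fin 4 → ℝ) :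
    ptFst (∑ α : Fin 4, ∑ β : Fin 4, (π α β : ℂ) • PLat α β) =
      ∑ γ : Fin 4, ∑ δ : Fin 4,
        (((∑ α : Fin 4, ∑ β : Fin 4, π α β * (bellSign α γ * bellSign β δ)) / 4 : ℝ) : ℂ) •
          PLat γ δ := by
  have h : ptFst (∑ α : Fin 4, ∑ β : Fin 4, (π α β : ℂ) • PLat α β) =
      ∑ i : Fin 4 × Fin 4, (π i.1 i.2 : ℂ) • ptFst (PLat i.1 i.2) := by
    ext x y
    simp [ptFst, Fintype.sum_prod_type, Matrix.sum_apply]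
  simp_rw [h, ptFst_PLat, ← Fintype.sum_prod_type', Finset.smul_sum]
  rw [Finset.sum_comm]
  refine Finset.sum_congr rfl fun j _ => ?_
  simp_rw [smul_smul, ← Finset.sum_smul]
  congr 1
  push_cast
  rw [Finset.sum_div]
  refine Finset.sum_congr rfl fun i _ => ?_
  ring

theorem sum_mul_bellSign (π : Fin 4 → Fin 4 → ℝ)
    (hsum : ∑ α : Fin 4, ∑ β : Fin 4, π α β = 1) (γ δ : Fin 4) :
    ∑ α : Fin 4, ∑ β : Fin 4, π α β * (bellSign α γ * bellSign β δ) =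
      1 - 2 * ((∑ β ∈ Finset.univ.erase (δ + 2), π (γ + 2) β)
        + ∑ α ∈ Finset.univ.erase (γ + 2), π α (δ + 2)) := by
  rw [← hsum]
  simp only [bellSign, Finset.sum_erase_eq_sub (Finset.mem_univ _)]
  generalize γ + 2 = c
  generalize δ + 2 = d
  fin_cases c <;> fin_cases d <;> simp [Fin.sum_univ_four] <;> ring

theorem posSemidef_sum_smul_vecMulVec_iff {ι n : Type*} [Fintype ι] [DecidableEq ι] [Fintype n]
    (v : ι → n → ℂ) (hv : ∀ i j, star (v i) ⬝ᵥ v j = if i = j then 1 else 0) (c : ι → ℝ) :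
    (∑ i, (c i : ℂ) • vecMulVec (v i) (star (v i))).PosSemidef ↔ ∀ i, 0 ≤ c i := by
  constructor
  · intro h i
    have hi := h.dotProduct_mulVec_nonneg (v i)
    simp only [sum_mulVec, smul_mulVec, vecMulVec_mulVec, hv, dotProduct_sum, dotProduct_smul] at hi
    simpa [hv] using hi
  · intro h
    refine posSemidef_sum _ fun i _ => ?_
    exact (posSemidef_vecMulVec_self_star (v i)).smul (by exact_mod_cast h i)

/-- Equations (20)–(21) of the paper: the spectral decomposition of the partial transpose
of `ρ_π = ∑ π_{αβ} P_{αβ}`, and the PPT criterion `Q¹_{γδ} + Q²_{γδ} ≤ 1/2`. -/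
theorem partialTranspose_lattice_state (π : Fin 4 → Fin 4 → ℝ)
    (hpos : ∀ α β, 0 ≤ π α β)
    (hsum : ∑ α : Fin 4, ∑ β : Fin 4, π α β = 1) :
    ptFst (∑ α : Fin 4, ∑ β : Fin 4, (π α β : ℂ) • PLat α β)
        = ∑ γ : Fin 4, ∑ δ : Fin 4,
            (((1 - 2 * ((∑ β ∈ Finset.univ.erase (δ + 2), π (γ + 2) β)
              + ∑ α ∈ Finset.univ.erase (γ + 2), π α (δ + 2))) / 4 : ℝ) : ℂ) • PLat γ δ
      ∧ (IsPPT (∑ α : Fin 4, ∑ β : Fin 4, (π α β : ℂ) • PLat α β)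
          ↔ ∀ γ δ : Fin 4,
              (∑ β ∈ Finset.univ.erase δ, π γ β) + (∑ α ∈ Finset.univ.erase γ, π α δ)
                ≤ 1 / 2) := by
  have hpt : ptFst (∑ α : Fin 4, ∑ β : Fin 4, (π α β : ℂ) • PLat α β)
        = ∑ γ : Fin 4, ∑ δ : Fin 4,
            (((1 - 2 * ((∑ β ∈ Finset.univ.erase (δ + 2), π (γ + 2) β)
              + ∑ α ∈ Finset.univ.erase (γ + 2), π α (δ + 2))) / 4 : ℝ) : ℂ) • PLat γ δ := by
    rw [ptFst_sum_smul_PLat]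
    simp_rw [sum_mul_bellSign π hsum]
  refine ⟨hpt, ?_⟩
  rw [IsPPT, hpt, ← Fintype.sum_prod_type']
  refine (posSemidef_sum_smul_vecMulVec_iff (fun i : Fin 4 × Fin 4 => PsiLat i.1 i.2)
    PsiLat_orthonormal _).trans ⟨fun h γ δ => ?_, fun h i => ?_⟩
  · have h' := h (γ + 2, δ + 2)
    simp only [add_assoc, show (2 + 2 : Fin 4) = 0 from rfl, add_zero] at h'
    linarith
  · have h' := h (i.1 + 2) (i.2 + 2)
    linarith
end
end

section
/- Among the lattice states ρ_I = (1/N_I) Σ_{(α,β)∈I} P_{αβ}, I ⊆ L₁₆ nonempty with N_I elements: if N_I ∈ {1, 2, 3, 5, 7} then ρ_I is not PPT for any choice of I; and if N_I ≥ 12 then ρ_I is PPT for every choice of I. -/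
open Matrix
open scoped Kronecker ComplexOrder

noncomputable section

/-- The lattice state `ρ_I = (1/N_I) ∑_{(α,β)∈I} P_{αβ}`. -/
def rhoLat (I : Finset (Fin 4 × Fin 4)) :
    Matrix ((Fin 2 × Fin 2) × (Fin 2 × Fin 2)) ((Fin 2 × Fin 2) × (Fin 2 × Fin 2)) ℂ :=
  (I.card : ℂ)⁻¹ • ∑ p ∈ I, PLat p.1 p.2

/-- The matrix entries of twice the projection onto the Bell vector attached to `σ_α`. -/
def pauliEntry (α : Fin 4) (i j k l : Fin 2) : ℂ :=
  pauli α j i * star (pauli α l k)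

/-- The sign with which `P_γ` occurs in the partial transpose of `P_α` for one pair of qubits:
it is `-1` exactly when `γ = α + 2`. -/
def ptSign : Matrix (Fin 4) (Fin 4) ℤ :=
  !![1, 1, -1, 1; 1, 1, 1, -1; -1, 1, 1, 1; 1, -1, 1, 1]

/-- Four times the number of elements of `I` times the eigenvalue of the partial transpose
of `rhoLat I` at `PsiLat g.1 g.2`. -/
def ptWeight (I : Finset (Fin 4 × Fin 4)) (g : Fin 4 × Fin 4) : ℤ :=
  ∑ p ∈ I, ptSign p.1 g.1 * ptSign p.2 g.2

lemma pauliEntry_swap (α : Fin 4) (i j k l : Fin 2) :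
    pauliEntry α k j i l = 2⁻¹ * ∑ γ, (ptSign α γ : ℂ) * pauliEntry γ i j k l := by
  fin_cases α <;> fin_cases i <;> fin_cases j <;> fin_cases k <;> fin_cases l <;>
    simp [pauliEntry, ptSign, pauli, Fin.sum_univ_four] <;> norm_num

lemma sum_star_pauli_mul_pauli (α γ : Fin 4) :
    ∑ i, ∑ j, star (pauli α j i) * pauli γ j i = if α = γ then 2 else 0 := by
  fin_cases α <;> fin_cases γ <;> simp [pauli, Fin.sum_univ_two] <;> norm_num

lemma psiLat_apply (α β : Fin 4) (x : (Fin 2 × Fin 2) × (Fin 2 × Fin 2)) :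
    PsiLat α β x = 2⁻¹ * (pauli α x.2.1 x.1.1 * pauli β x.2.2 x.1.2) := by
  have h4 : Real.sqrt 4 = 2 := by
    rw [show (4 : ℝ) = 2 ^ 2 by norm_num]; exact Real.sqrt_sq (by norm_num)
  simp only [PsiLat, mulVec, dotProduct, maxEntVec, sigma2, kroneckerMap_apply, one_apply]
  rw [Fintype.sum_prod_type]
  simp [h4]
  ring

lemma pLat_apply (α β : Fin 4) (x y : (Fin 2 × Fin 2) × (Fin 2 × Fin 2)) :
    PLat α β x y = 4⁻¹ * (pauliEntry α x.1.1 x.2.1 y.1.1 y.2.1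
      * pauliEntry β x.1.2 x.2.2 y.1.2 y.2.2) := by
  simp only [PLat, vecMulVec_apply, Pi.star_apply, psiLat_apply, pauliEntry, star_mul', star_inv₀,
    star_ofNat]
  ring

lemma ptFst_pLat (α β : Fin 4) :
    ptFst (PLat α β) =
      (4⁻¹ : ℂ) • ∑ g : Fin 4 × Fin 4, ((ptSign α g.1 * ptSign β g.2 : ℤ) : ℂ) • PLat g.1 g.2 := by
  ext x y
  simp only [ptFst, of_apply, Matrix.smul_apply, Matrix.sum_apply, pLat_apply, smul_eq_mul]
  rw [pauliEntry_swap α, pauliEntry_swap β, Fintype.sum_prod_type, mul_mul_mul_comm,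
    Finset.sum_mul_sum]
  simp only [Finset.mul_sum]
  refine Finset.sum_congr rfl fun γ _ => Finset.sum_congr rfl fun δ _ => ?_
  push_cast
  ring

lemma ptFst_rhoLat (I : Finset (Fin 4 × Fin 4)) :
    ptFst (rhoLat I) =
      ((4 * I.card : ℝ)⁻¹ : ℂ) • ∑ g, ((ptWeight I g : ℤ) : ℂ) • PLat g.1 g.2 := by
  have h : ptFst (rhoLat I) = (I.card : ℂ)⁻¹ • ∑ p ∈ I, ptFst (PLat p.1 p.2) := by
    ext x y
    simp [rhoLat, ptFst, Matrix.sum_apply]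
  simp only [h, ptFst_pLat, ← Finset.smul_sum, smul_smul]
  rw [Finset.sum_comm]
  simp only [← Finset.sum_smul, ptWeight]
  push_cast
  rw [mul_inv, mul_comm]

lemma star_psiLat_dotProduct_psiLat (g h : Fin 4 × Fin 4) :
    star (PsiLat g.1 g.2) ⬝ᵥ PsiLat h.1 h.2 = if g = h then 1 else 0 := by
  have key : star (PsiLat g.1 g.2) ⬝ᵥ PsiLat h.1 h.2 =
      4⁻¹ * ((∑ i, ∑ j, star (pauli g.1 j i) * pauli h.1 j i)
        * ∑ i, ∑ j, star (pauli g.2 j i) * pauli h.2 j i) := by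
    simp only [dotProduct, Pi.star_apply, psiLat_apply, Fintype.sum_prod_type, Fin.sum_univ_two,
      star_mul', star_inv₀, star_ofNat]
    ring
  rw [key, sum_star_pauli_mul_pauli, sum_star_pauli_mul_pauli]
  by_cases h1 : g.1 = h.1 <;> by_cases h2 : g.2 = h.2 <;> (simp [h1, h2, Prod.ext_iff]; try norm_num)

lemma isPPT_rhoLat_iff (I : Finset (Fin 4 × Fin 4)) (hI : I.Nonempty) :
    IsPPT (rhoLat I) ↔ ∀ g, 0 ≤ ptWeight I g := by
  have hN : (0 : ℝ) < (4 * I.card : ℝ)⁻¹ := by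
    have := hI.card_pos
    positivity
  rw [IsPPT, ptFst_rhoLat]
  constructor
  · intro h g
    have h1 := h.dotProduct_mulVec_nonneg (PsiLat g.1 g.2)
    simp only [smul_mulVec, sum_mulVec, dotProduct_smul, dotProduct_sum, PLat, vecMulVec_mulVec,
      star_psiLat_dotProduct_psiLat] at h1
    simp at h1
    have h2 : 0 ≤ (I.card : ℝ)⁻¹ * 4⁻¹ * (ptWeight I g : ℝ) :=
      Complex.zero_le_real.1 (by push_cast; exact h1)
    rw [← mul_inv, mul_comm (I.card : ℝ)] at h2
    exact_mod_cast nonneg_of_mul_nonneg_right h2 hN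
  · intro h
    refine PosSemidef.smul (posSemidef_sum _ fun g _ => ?_) ?_
    · exact (posSemidef_vecMulVec_self_star _).smul (by exact_mod_cast h g)
    · exact_mod_cast hN.le

/-- The membership indicator of `I`. -/
def cell (I : Finset (Fin 4 × Fin 4)) (i j : Fin 4) : ℤ := if (i, j) ∈ I then 1 else 0

lemma cell_eq (I : Finset (Fin 4 × Fin 4)) (i j : Fin 4) : cell I i j = 0 ∨ cell I i j = 1 := by
  unfold cell; split_ifs <;> simp

lemma card_eq_sum_cell (I : Finset (Fin 4 × Fin 4)) :
    (I.card : ℤ) = ∑ i, ∑ j, cell I i j := by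
  rw [← Fintype.sum_prod_type']
  simp [cell]

lemma ptWeight_add_two (I : Finset (Fin 4 × Fin 4)) (c d : Fin 4) :
    ptWeight I (c + 2, d + 2) =
      I.card - 2 * (∑ j, cell I c j + ∑ i, cell I i d - 2 * cell I c d) := by
  have h : ptWeight I (c + 2, d + 2) =
      ∑ i, ∑ j, cell I i j * (ptSign i (c + 2) * ptSign j (d + 2)) := by
    rw [← Fintype.sum_prod_type']
    simp [cell, ptWeight]
  rw [h, card_eq_sum_cell]
  fin_cases c <;> fin_cases d <;> simp [ptSign, Fin.sum_univ_four] <;> ring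

lemma row_sum_bounds {N : ℤ} (hN : N = 1 ∨ N = 2 ∨ N = 3 ∨ N = 5 ∨ N = 7) {x k : Fin 4 → ℤ}
    (hx : ∀ j, x j = 0 ∨ x j = 1) (hk : ∑ j, k j = N)
    (h : ∀ j, 2 * (∑ i, x i + k j - 2 * x j) ≤ N) (hxk : ∀ j, x j ≤ k j) :
    ∑ j, x j ≤ 2 ∧ ((∀ j, k j ≤ 2) → ∑ j, x j ≤ 1) ∧ ((∀ j, k j ≤ 1) → ∑ j, x j ≤ 0) := by
  simp only [Fin.forall_fin_succ, Fin.sum_univ_four] at *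
  simp at *
  obtain ⟨h0, h1, h2, h3⟩ := hx
  rcases hN with rfl | rfl | rfl | rfl | rfl <;> rcases h0 with h0 | h0 <;>
    rcases h1 with h1 | h1 <;> rcases h2 with h2 | h2 <;> rcases h3 with h3 | h3 <;>
    simp only [h0, h1, h2, h3] at * <;> omega

/-- From the paper's Section 3.1: there are no PPT lattice states `ρ_I` with
`N_I ∈ {1,2,3,5,7}`, while all lattice states with `N_I ≥ 12` are PPT. -/
theorem lattice_state_ppt_cardinality (I : Finset (Fin 4 × Fin 4)) (hI : I.Nonempty) :
    (I.card ∈ ({1, 2, 3, 5, 7} : Set ℕ) → ¬ IsPPT (rhoLat I))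
      ∧ (12 ≤ I.card → IsPPT (rhoLat I)) := by
  rw [isPPT_rhoLat_iff I hI]
  have hcell := cell_eq I
  have hcard := card_eq_sum_cell I
  have hweight := ptWeight_add_two I
  have hcol : ∑ j, ∑ i, cell I i j = I.card := by rw [hcard, Finset.sum_comm]
  have hle_row : ∀ i j, cell I i j ≤ ∑ j, cell I i j := fun i j =>
    Finset.single_le_sum (f := fun j => cell I i j) (fun j _ => by have := hcell i j; omega)
      (Finset.mem_univ j)
  have hle_col : ∀ i j, cell I i j ≤ ∑ i, cell I i j := fun i j =>
    Finset.single_le_sum (f := fun i => cell I i j) (fun i _ => by have := hcell i j; omega)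
      (Finset.mem_univ i)
  constructor
  · intro hc h
    have hN : (I.card : ℤ) = 1 ∨ (I.card : ℤ) = 2 ∨ (I.card : ℤ) = 3 ∨ (I.card : ℤ) = 5 ∨
        (I.card : ℤ) = 7 := by
      simp only [Set.mem_insert_iff, Set.mem_singleton_iff] at hc
      omega
    have row i := row_sum_bounds hN (hcell i) hcol
      (fun j => by have := h (i + 2, j + 2); rw [hweight] at this; omega) (hle_col i)
    have col j := row_sum_bounds hN (fun i => hcell i j) hcard.symm
      (fun i => by have := h (i + 2, j + 2); rw [hweight] at this; omega) fun i => hle_row i j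
    have row_le_one i := (row i).2.1 fun j => (col j).1
    have col_le_one j := (col j).2.1 fun i => (row i).1
    have row_le_zero i := (row i).2.2 col_le_one
    have : (I.card : ℤ) ≤ 0 := hcard ▸ Finset.sum_nonpos fun i _ => row_le_zero i
    omega
  · intro hc g
    have hg : g = (g.1 + 2 + 2, g.2 + 2 + 2) := by revert g; decide
    rw [hg, hweight]
    generalize g.1 + 2 = c
    generalize g.2 + 2 = d
    have hcross : ∑ j, cell I c j + ∑ i, cell I i d - 2 * cell I c d ≤ 6 := by
      have hr : ∑ j ∈ {d}ᶜ, cell I c j ≤ 3 := by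
        simpa [Finset.card_compl] using Finset.sum_le_card_nsmul {d}ᶜ (cell I c) 1 fun j _ => by
          have := hcell c j; omega
      have hk : ∑ i ∈ {c}ᶜ, cell I i d ≤ 3 := by
        simpa [Finset.card_compl] using Finset.sum_le_card_nsmul {c}ᶜ (cell I · d) 1 fun i _ => by
          have := hcell i d; omega
      rw [Fintype.sum_eq_add_sum_compl d, Fintype.sum_eq_add_sum_compl c]
      omega
    omega
end
end
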